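/- arXiv:1305.2141 — 2 statements merged into one kernel-verified Lean document; each statement's English description precedes it below -/
import Mathlib

section
/- Let n, m, h be positive integers with m ≤ n. For any finite abelian group G of order n and any m-element subset A of G, the h-fold sumset hA has size at least u(n,m,h); consequently ρ(G,m,h) ≥ u(n,m,h). -/
open Finset

/-- The `h`-fold sumset of `A`: all sums of `h` not-necessarily-distinct elements of `A`. -/
def hFoldSum {G : Type*} [AddCommMonoid G] [DecidableEq G] (h : ℕ) (A : Finset G) : Finset G :=
  (Fintype.piFinset fun _ : Fin h => A).image fun f => ∑ i, f i

/-- The `h`-fold restricted sumset of `A`: all sums of `h` pairwise distinct elements of `A`. -/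
def hFoldRSum {G : Type*} [AddCommMonoid G] [DecidableEq G] (h : ℕ) (A : Finset G) : Finset G :=
  (A.powersetCard h).image fun s => ∑ x ∈ s, x

/-- `ρ(G,m,h)`: minimum size of the `h`-fold sumset over `m`-element subsets of `G`. -/
noncomputable def rho (G : Type*) [AddCommMonoid G] [DecidableEq G] (m h : ℕ) : ℕ :=
  sInf { k | ∃ A : Finset G, A.card = m ∧ (hFoldSum h A).card = k }

/-- `ρ^(G,m,h)`: minimum size of the `h`-fold restricted sumset over `m`-element subsets. -/
noncomputable def rhoHat (G : Type*) [AddCommMonoid G] [DecidableEq G] (m h : ℕ) : ℕ :=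
  sInf { k | ∃ A : Finset G, A.card = m ∧ (hFoldRSum h A).card = k }

/-- `f_d = (h⌈m/d⌉ - h + 1) d`. -/
def fd (m h d : ℕ) : ℕ := (h * ((m + d - 1) / d) - h + 1) * d

/-- `u(n,m,h) = min { f_d : d ∣ n, d > 0 }`. -/
noncomputable def uFun (n m h : ℕ) : ℕ := sInf { k | ∃ d : ℕ, d ∣ n ∧ 0 < d ∧ k = fd m h d }

/-- The set `A_d(n,m) ⊆ ℤ_n`, with `c = ⌈m/d⌉ - 1`, `k = m - cd`,
`H = {j·(n/d) : j = 0,…,d-1}`:  `A_d(n,m) = ⋃_{i<c} (i+H) ∪ {c + j·(n/d) : j < k}`. -/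
def Aset (n m d : ℕ) : Finset (ZMod n) :=
  ((Finset.range ((m + d - 1) / d - 1)) ×ˢ (Finset.range d)).image
    (fun p => (p.1 : ZMod n) + (p.2 : ZMod n) * ((n / d : ℕ) : ZMod n)) ∪
  (Finset.range (m - ((m + d - 1) / d - 1) * d)).image
    (fun j : ℕ => (((m + d - 1) / d - 1 : ℕ) : ZMod n) + (j : ZMod n) * ((n / d : ℕ) : ZMod n))

/-- The set `B_d(n,m;k₁,k₂,g,j₀)` (with `c` such that `m = k₁ + (c-1)d + k₂`):
`{j·(n/d) : j < k₁} ∪ ⋃_{1 ≤ i ≤ c-1} (i·g + H) ∪ {c·g + (j₀+j)·(n/d) : j < k₂}`. -/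
def Bset (n d k₁ k₂ c j₀ : ℕ) (g : ZMod n) : Finset (ZMod n) :=
  (Finset.range k₁).image (fun j : ℕ => (j : ZMod n) * ((n / d : ℕ) : ZMod n)) ∪
  ((Finset.Ico 1 c) ×ˢ (Finset.range d)).image
    (fun p => p.1 • g + (p.2 : ZMod n) * ((n / d : ℕ) : ZMod n)) ∪
  (Finset.range k₂).image
    (fun j => c • g + ((j₀ + j : ℕ) : ZMod n) * ((n / d : ℕ) : ZMod n))

section helpers
open scoped Pointwise

/-- stabilizer -/
def stb {G : Type*} [AddCommGroup G] (C : Finset G) : AddSubgroup G where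
  carrier := {g | ∀ c, g + c ∈ C ↔ c ∈ C}
  zero_mem' := by intro c; simp
  add_mem' := by
    intro a b ha hb c
    rw [add_assoc, ha, hb]
  neg_mem' := by
    intro a ha c
    rw [← ha (-a + c)]; simp

theorem mem_stb {G : Type*} [AddCommGroup G] (C : Finset G) (g : G) :
    g ∈ stb C ↔ ∀ c, g + c ∈ C ↔ c ∈ C := Iff.rfl

theorem mem_stb_of {G : Type*} [AddCommGroup G] [DecidableEq G] (C : Finset G) (g : G)
    (hg : ∀ c ∈ C, g + c ∈ C) : g ∈ stb C := by
  have h1 : C.image (fun c => g + c) = C := by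
    apply Finset.eq_of_subset_of_card_le
    · intro x hx
      obtain ⟨c, hc, rfl⟩ := Finset.mem_image.1 hx
      exact hg c hc
    · rw [Finset.card_image_of_injective _ (add_right_injective g)]
  intro c
  refine ⟨fun h => ?_, hg c⟩
  rw [← h1] at h
  obtain ⟨d, hd, e⟩ := Finset.mem_image.1 h
  have : d = c := by simpa using e
  exact this ▸ hd

/-- finset of a subgroup -/
noncomputable def fs {G : Type*} [AddCommGroup G] [Fintype G] (H : AddSubgroup G) : Finset G :=
  open Classical in Finset.univ.filter (· ∈ H)

theorem mem_fs {G : Type*} [AddCommGroup G] [Fintype G] (H : AddSubgroup G) (g : G) :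
    g ∈ fs H ↔ g ∈ H := by simp [fs]

theorem fs_mono {G : Type*} [AddCommGroup G] [Fintype G] {H K : AddSubgroup G} (h : H ≤ K) :
    (fs H).card ≤ (fs K).card :=
  Finset.card_le_card fun x hx => (mem_fs _ _).2 (h ((mem_fs _ _).1 hx))

theorem fs_pos {G : Type*} [AddCommGroup G] [Fintype G] (H : AddSubgroup G) :
    0 < (fs H).card := Finset.card_pos.2 ⟨0, (mem_fs _ _).2 H.zero_mem⟩

/-- product counting -/
theorem prod_count {G : Type*} [AddCommGroup G] [Fintype G] [DecidableEq G]
    (H₁ H₂ : AddSubgroup G) (U V W : Finset G) (hU : ∀ u ∈ U, u ∈ H₂) (hV : ∀ v ∈ V, v ∈ H₁)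
    (hW : ∀ u ∈ U, ∀ v ∈ V, u + v ∈ W) :
    U.card * V.card ≤ (fs (H₁ ⊓ H₂)).card * W.card := by
  rw [← Finset.card_product]
  refine Finset.card_le_mul_card_image_of_maps_to (f := fun p : G × G => p.1 + p.2) ?_ _ ?_
  · intro p hp
    rw [Finset.mem_product] at hp
    exact hW _ hp.1 _ hp.2
  · intro w hw
    rcases Finset.eq_empty_or_nonempty {p ∈ U ×ˢ V | p.1 + p.2 = w} with h | ⟨q, hq⟩
    · rw [h]; simp
    · rw [Finset.mem_filter, Finset.mem_product] at hq
      refine Finset.card_le_card_of_injOn (fun p => p.1 - q.1) ?_ ?_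
      · intro p hp
        rw [Finset.mem_coe, Finset.mem_filter, Finset.mem_product] at hp
        rw [Finset.mem_coe, mem_fs]
        refine ⟨?_, H₂.sub_mem (hU _ hp.1.1) (hU _ hq.1.1)⟩
        have : p.1 - q.1 = q.2 - p.2 := by
          rw [sub_eq_sub_iff_add_eq_add, hp.2, add_comm, hq.2]
        show p.1 - q.1 ∈ H₁
        rw [this]
        exact H₁.sub_mem (hV _ hq.1.2) (hV _ hp.1.2)
      · intro p hp p' hp' e
        rw [Finset.mem_coe, Finset.mem_filter] at hp hp'
        have e1 : p.1 = p'.1 := by simpa using e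
        have e2 := hp.2.trans hp'.2.symm
        rw [e1] at e2
        exact Prod.ext e1 (by simpa using e2)

theorem arith_key (k0 k1 b a P : ℕ) (hb : k0 ≤ b) (hb' : k0 + b ≤ k1) (hab : b ≤ a) (h0 : 0 < k0)
    (hP : a * (k1 - b) ≤ k0 * P) : k1 ≤ P + k0 := by
  obtain ⟨t, rfl⟩ := Nat.exists_eq_add_of_le hb'
  obtain ⟨s, rfl⟩ := Nat.exists_eq_add_of_le hb
  have e : k0 + (k0 + s) + t - (k0 + s) = k0 + t := by omega
  rw [e] at hP
  have : k0 * (k0 + s + t) ≤ k0 * P := by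
    calc k0 * (k0 + s + t) ≤ (k0 + s) * (k0 + t) := by nlinarith [Nat.zero_le (s * t)]
      _ ≤ a * (k0 + t) := Nat.mul_le_mul_right _ hab
      _ ≤ _ := hP
  have := Nat.le_of_mul_le_mul_left this h0
  omega

theorem local_count {G : Type*} [AddCommGroup G] [Fintype G] [DecidableEq G]
    (C₁ C₂ : Finset G) (H₁ H₂ : AddSubgroup G) (h1 : H₁ ≤ stb C₁) (h2 : H₂ ≤ stb C₂) (x : G) :
    ∃ a b a' b' : ℕ, a + a' = (fs H₂).card ∧ b + b' = (fs H₁).card ∧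
      (a = 0 ∨ (fs (H₁ ⊓ H₂)).card ≤ a) ∧ (a' = 0 ∨ (fs (H₁ ⊓ H₂)).card ≤ a') ∧
      (b = 0 ∨ (fs (H₁ ⊓ H₂)).card ≤ b) ∧ (b' = 0 ∨ (fs (H₁ ⊓ H₂)).card ≤ b') ∧
      (x ∉ C₁ → a ≠ 0) ∧ (x ∈ C₁ → a' ≠ 0) ∧ (x ∉ C₂ → b ≠ 0) ∧ (x ∈ C₂ → b' ≠ 0) ∧
      a * b' ≤ (fs (H₁ ⊓ H₂)).card * (C₂ \ C₁).card ∧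
      a' * b ≤ (fs (H₁ ⊓ H₂)).card * (C₁ \ C₂).card := by
  have key : ∀ (H : AddSubgroup G) (p : G → Prop) [DecidablePred p],
      H₁ ⊓ H₂ ≤ H → (∀ g ∈ H₁ ⊓ H₂, ∀ y, p y → p (g + y)) →
      (((fs H).filter p).card = 0 ∨ (fs (H₁ ⊓ H₂)).card ≤ ((fs H).filter p).card) := by
    intro H p _ hH hp
    rcases Finset.eq_empty_or_nonempty ((fs H).filter p) with h | ⟨q, hq⟩
    · left; rw [h]; simp
    · right
      rw [Finset.mem_filter, mem_fs] at hq
      refine Finset.card_le_card_of_injOn (fun g => g + q) ?_ ?_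
      · intro g hg
        rw [Finset.mem_coe, mem_fs] at hg
        rw [Finset.mem_coe, Finset.mem_filter, mem_fs]
        exact ⟨H.add_mem (hH hg) hq.1, hp g hg q hq.2⟩
      · intro g _ g' _ e
        simpa using e
  have s1 : ∀ g ∈ H₁, ∀ c, g + c ∈ C₁ ↔ c ∈ C₁ := fun g hg => h1 hg
  have s2 : ∀ g ∈ H₂, ∀ c, g + c ∈ C₂ ↔ c ∈ C₂ := fun g hg => h2 hg
  have ne : ∀ (H : AddSubgroup G) (p : G → Prop) [DecidablePred p], p 0 →
      ((fs H).filter p).card ≠ 0 := by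
    intro H p _ hp
    rw [← Nat.pos_iff_ne_zero, Finset.card_pos]
    exact ⟨0, Finset.mem_filter.2 ⟨(mem_fs _ _).2 H.zero_mem, hp⟩⟩
  refine ⟨((fs H₂).filter (fun g => g + x ∉ C₁)).card, ((fs H₁).filter (fun g => g + x ∉ C₂)).card,
    ((fs H₂).filter (fun g => g + x ∈ C₁)).card, ((fs H₁).filter (fun g => g + x ∈ C₂)).card,
    ?_, ?_, ?_, ?_, ?_, ?_, ?_, ?_, ?_, ?_, ?_, ?_⟩
  · rw [add_comm]; exact Finset.card_filter_add_card_filter_not _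
  · rw [add_comm]; exact Finset.card_filter_add_card_filter_not _
  · exact key _ _ inf_le_right (fun g hg y hy => by rwa [add_assoc, s1 g hg.1])
  · exact key _ _ inf_le_right (fun g hg y hy => by rwa [add_assoc, s1 g hg.1])
  · exact key _ _ inf_le_left (fun g hg y hy => by rwa [add_assoc, s2 g hg.2])
  · exact key _ _ inf_le_left (fun g hg y hy => by rwa [add_assoc, s2 g hg.2])
  · intro h; exact ne _ _ (by simpa using h)
  · intro h; exact ne _ _ (by simpa using h)
  · intro h; exact ne _ _ (by simpa using h)
  · intro h; exact ne _ _ (by simpa using h)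
  · rw [← Finset.card_image_of_injective (C₂ \ C₁) (add_right_injective (-x))]
    refine prod_count H₁ H₂ _ _ _ (fun u hu => (mem_fs _ _).1 (Finset.mem_filter.1 hu).1)
      (fun u hu => (mem_fs _ _).1 (Finset.mem_filter.1 hu).1) ?_
    intro u hu v hv
    rw [Finset.mem_filter, mem_fs] at hu hv
    refine Finset.mem_image.2 ⟨u + v + x, Finset.mem_sdiff.2 ⟨?_, ?_⟩, by abel⟩
    · rw [add_assoc, s2 _ hu.1]; exact hv.2
    · rw [add_comm u v, add_assoc, s1 _ hv.1]; exact hu.2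
  · rw [← Finset.card_image_of_injective (C₁ \ C₂) (add_right_injective (-x))]
    refine prod_count H₁ H₂ _ _ _ (fun u hu => (mem_fs _ _).1 (Finset.mem_filter.1 hu).1)
      (fun u hu => (mem_fs _ _).1 (Finset.mem_filter.1 hu).1) ?_
    intro u hu v hv
    rw [Finset.mem_filter, mem_fs] at hu hv
    refine Finset.mem_image.2 ⟨u + v + x, Finset.mem_sdiff.2 ⟨?_, ?_⟩, by abel⟩
    · rw [add_comm u v, add_assoc, s1 _ hv.1]; exact hu.2
    · rw [add_assoc, s2 _ hu.1]; exact hv.2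

theorem union_core {G : Type*} [AddCommGroup G] [Fintype G] [DecidableEq G]
    (C₁ C₂ : Finset G) (H₁ H₂ : AddSubgroup G) (h1 : H₁ ≤ stb C₁) (h2 : H₂ ≤ stb C₂)
    (n1 : (C₂ \ C₁).Nonempty) (n2 : (C₁ \ C₂).Nonempty) :
    (fs H₁).card ≤ (C₂ \ C₁).card + (fs (H₁ ⊓ H₂)).card ∨
    (fs H₂).card ≤ (C₁ \ C₂).card + (fs (H₁ ⊓ H₂)).card := by
  obtain ⟨x, hx⟩ := n1
  obtain ⟨y, hy⟩ := n2
  rw [Finset.mem_sdiff] at hx hy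
  have h0 := fs_pos (H₁ ⊓ H₂)
  obtain ⟨a, b, a', b', e1, e2, c1, c2, c3, c4, d1, d2, d3, d4, f1, f2⟩ :=
    local_count C₁ C₂ H₁ H₂ h1 h2 x
  obtain ⟨p, q, p', q', E1, E2, g1, g2, g3, g4, i1, i2, i3, i4, j1, j2⟩ :=
    local_count C₁ C₂ H₁ H₂ h1 h2 y
  generalize (fs (H₁ ⊓ H₂)).card = k0 at *
  generalize (fs H₁).card = k1 at *
  generalize (fs H₂).card = k2 at *
  generalize (C₂ \ C₁).card = P at *
  generalize (C₁ \ C₂).card = Q at *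
  have d1 := d1 hx.2
  have d4 := d4 hx.1
  have i2 := i2 hy.1
  have i3 := i3 hy.2
  have mid : ∀ a b a' b' : ℕ, a + a' = k2 → b + b' = k1 → k0 ≤ a → k0 ≤ a' → k0 ≤ b → k0 ≤ b' →
      a * b' ≤ k0 * P → a' * b ≤ k0 * Q → k1 ≤ P + k0 ∨ k2 ≤ Q + k0 := by
    intro a b a' b' e1 e2 h1 h2 h3 h4 h5 h6
    rcases le_total b a with h | h
    · left
      refine arith_key k0 k1 b a P h3 (by omega) h h0 ?_
      rwa [show k1 - b = b' by omega]
    · right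
      refine arith_key k0 k2 a b Q h1 (by omega) h h0 ?_
      rwa [show k2 - a = a' by omega, mul_comm]
  have A1 : (k1 ≤ P + k0 ∨ k2 ≤ Q + k0) ∨ k2 ≤ P := by
    rcases c3 with c3 | c3
    · left; left
      have : k0 * b' ≤ k0 * P := le_trans (Nat.mul_le_mul_right _ (by omega)) f1
      have := Nat.le_of_mul_le_mul_left this h0
      omega
    · rcases c2 with c2 | c2
      · right
        have : k0 * a ≤ k0 * P := by
          refine le_trans ?_ f1
          rw [mul_comm]; exact Nat.mul_le_mul_left _ (by omega)
        have := Nat.le_of_mul_le_mul_left this h0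
        omega
      · left; exact mid a b a' b' e1 e2 (by omega) c2 c3 (by omega) f1 f2
  have A2 : (k1 ≤ P + k0 ∨ k2 ≤ Q + k0) ∨ k1 ≤ Q := by
    rcases g1 with c3 | c3
    · left; right
      have : k0 * p' ≤ k0 * Q := by
        refine le_trans ?_ j2
        rw [mul_comm]; exact Nat.mul_le_mul_left _ (by omega)
      have := Nat.le_of_mul_le_mul_left this h0
      omega
    · rcases g4 with c2 | c2
      · right
        have : k0 * q ≤ k0 * Q := le_trans (Nat.mul_le_mul_right _ (by omega)) j2
        have := Nat.le_of_mul_le_mul_left this h0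
        omega
      · left; exact mid p q p' q' E1 E2 c3 (by omega) (by omega) c2 j1 j2
  omega

theorem union_lem {G : Type*} [AddCommGroup G] [Fintype G] [DecidableEq G]
    (C₁ C₂ : Finset G) (N : ℕ) (h1 : N ≤ C₁.card + (fs (stb C₁)).card)
    (h2 : N ≤ C₂.card + (fs (stb C₂)).card) :
    N ≤ (C₁ ∪ C₂).card + (fs (stb (C₁ ∪ C₂))).card := by
  rcases Finset.eq_empty_or_nonempty (C₂ \ C₁) with n1 | n1
  · rw [Finset.sdiff_eq_empty_iff_subset] at n1
    rwa [Finset.union_eq_left.2 n1]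
  rcases Finset.eq_empty_or_nonempty (C₁ \ C₂) with n2 | n2
  · rw [Finset.sdiff_eq_empty_iff_subset] at n2
    rwa [Finset.union_eq_right.2 n2]
  have hs : stb C₁ ⊓ stb C₂ ≤ stb (C₁ ∪ C₂) := by
    intro g hg c
    rw [Finset.mem_union, Finset.mem_union, hg.1 c, hg.2 c]
  have h3 := fs_mono hs
  have h4 : (C₁ ∪ C₂).card = (C₂ \ C₁).card + C₁.card := by
    rw [Finset.card_sdiff_add_card, Finset.union_comm]
  have h5 : (C₁ ∪ C₂).card = (C₁ \ C₂).card + C₂.card := by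
    rw [Finset.card_sdiff_add_card]
  have := union_core C₁ C₂ _ _ le_rfl le_rfl n1 n2
  omega

theorem dyson {G : Type*} [AddCommGroup G] [Fintype G] [DecidableEq G] (k : ℕ) :
    ∀ (A B : Finset G), B.card ≤ k → (0 : G) ∈ B → ∀ a ∈ A,
    ∃ C ⊆ A + B, a ∈ C ∧ A.card + B.card ≤ C.card + (fs (stb C)).card := by
  induction k with
  | zero =>
    intro A B hB h0
    have := Finset.card_pos.2 ⟨0, h0⟩
    omega
  | succ k ih =>
    intro A B hB h0 a ha
    by_cases hall : ∀ e ∈ A, ∀ b ∈ B, b + e ∈ A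
    · refine ⟨A, ?_, ha, ?_⟩
      · intro x hx
        exact Finset.mem_add.2 ⟨x, hx, 0, h0, by simp⟩
      · have : B ⊆ fs (stb A) := by
          intro b hb
          rw [mem_fs]
          exact mem_stb_of _ _ fun c hc => hall c hc b hb
        have := Finset.card_le_card this
        omega
    · push Not at hall
      obtain ⟨e, he, b, hb, hbe⟩ := hall
      have hc : (B.image (· + e)).card = B.card :=
        Finset.card_image_of_injective _ (add_left_injective e)
      have hc2 : (B.filter (fun b => b + e ∈ A)).card = (A ∩ B.image (· + e)).card := by
        rw [← Finset.card_image_of_injective (B.filter (fun b => b + e ∈ A))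
          (add_left_injective e)]
        congr 1
        ext x
        simp only [Finset.mem_image, Finset.mem_filter, Finset.mem_inter]
        constructor
        · rintro ⟨y, ⟨h1, h2⟩, rfl⟩
          exact ⟨h2, y, h1, rfl⟩
        · rintro ⟨h2, y, h1, rfl⟩
          exact ⟨y, ⟨h1, h2⟩, rfl⟩
      have hlt : (B.filter (fun b => b + e ∈ A)).card < B.card := by
        apply Finset.card_lt_card
        rw [Finset.filter_ssubset]
        exact ⟨b, hb, hbe⟩
      obtain ⟨C, hC, haC, hcard⟩ := ih (A ∪ B.image (· + e)) (B.filter (fun b => b + e ∈ A))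
        (by omega) (by simp [h0, he]) a (Finset.mem_union_left _ ha)
      refine ⟨C, hC.trans ?_, haC, ?_⟩
      · intro x hx
        obtain ⟨u, hu, v, hv, rfl⟩ := Finset.mem_add.1 hx
        rw [Finset.mem_filter] at hv
        rcases Finset.mem_union.1 hu with hu | hu
        · exact Finset.add_mem_add hu hv.1
        · obtain ⟨w, hw, rfl⟩ := Finset.mem_image.1 hu
          refine Finset.mem_add.2 ⟨v + e, hv.2, w, hw, by abel⟩
      · have := Finset.card_union_add_card_inter A (B.image (· + e))
        omega

theorem dyson' {G : Type*} [AddCommGroup G] [Fintype G] [DecidableEq G]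
    (A B : Finset G) (c : G) (hc : c ∈ A + B) :
    ∃ C ⊆ A + B, c ∈ C ∧ A.card + B.card ≤ C.card + (fs (stb C)).card := by
  obtain ⟨a, ha, b, hb, rfl⟩ := Finset.mem_add.1 hc
  have i1 : (A.image (· + b)).card = A.card :=
    Finset.card_image_of_injective _ (add_left_injective b)
  have i2 : (B.image (· - b)).card = B.card :=
    Finset.card_image_of_injective _ (sub_left_injective)
  obtain ⟨C, hC, h1, h2⟩ := dyson (B.card) (A.image (· + b)) (B.image (· - b)) i2.le
    (Finset.mem_image.2 ⟨b, hb, by simp⟩) (a + b) (Finset.mem_image.2 ⟨a, ha, rfl⟩)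
  refine ⟨C, hC.trans ?_, h1, by omega⟩
  intro x hx
  obtain ⟨u, hu, v, hv, rfl⟩ := Finset.mem_add.1 hx
  obtain ⟨u, hu', rfl⟩ := Finset.mem_image.1 hu
  obtain ⟨v, hv', rfl⟩ := Finset.mem_image.1 hv
  exact Finset.mem_add.2 ⟨u, hu', v, hv', by abel⟩

theorem kneser_weak {G : Type*} [AddCommGroup G] [Fintype G] [DecidableEq G]
    (A B : Finset G) (hA : A.Nonempty) (hB : B.Nonempty) :
    A.card + B.card ≤ (A + B).card + (fs (stb (A + B))).card := by
  have main : ∀ S : Finset G, S ⊆ A + B → S.Nonempty →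
      ∃ C ⊆ A + B, S ⊆ C ∧ A.card + B.card ≤ C.card + (fs (stb C)).card := by
    intro S
    induction S using Finset.induction_on with
    | empty => intro _ h; simp at h
    | insert c S hc ih =>
      intro hS _
      rw [Finset.insert_subset_iff] at hS
      obtain ⟨D, hD, hcD, hD'⟩ := dyson' A B c hS.1
      rcases Finset.eq_empty_or_nonempty S with rfl | hne
      · exact ⟨D, hD, by simpa using hcD, hD'⟩
      · obtain ⟨C, hC, hSC, hC'⟩ := ih hS.2 hne
        refine ⟨C ∪ D, Finset.union_subset hC hD, ?_, union_lem _ _ _ hC' hD'⟩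
        rw [Finset.insert_subset_iff]
        exact ⟨Finset.mem_union_right _ hcD, hSC.trans Finset.subset_union_left⟩
  obtain ⟨C, h1, h2, h3⟩ := main (A + B) subset_rfl (hA.add hB)
  rwa [Finset.Subset.antisymm h1 h2] at h3

theorem mem_hFold {G : Type*} [AddCommMonoid G] [DecidableEq G] (h : ℕ) (A : Finset G) (x : G) :
    x ∈ hFoldSum h A ↔ ∃ f : Fin h → G, (∀ i, f i ∈ A) ∧ ∑ i, f i = x := by
  simp [hFoldSum]

theorem hFold_succ {G : Type*} [AddCommMonoid G] [DecidableEq G] (h : ℕ) (A : Finset G) :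
    hFoldSum (h + 1) A = A + hFoldSum h A := by
  ext x
  rw [mem_hFold, Finset.mem_add]
  constructor
  · rintro ⟨f, hf, rfl⟩
    exact ⟨f 0, hf 0, ∑ i : Fin h, f i.succ, (mem_hFold _ _ _).2 ⟨fun i => f i.succ, fun i => hf _, rfl⟩,
      (Fin.sum_univ_succ f).symm⟩
  · rintro ⟨a, ha, y, hy, rfl⟩
    obtain ⟨f, hf, rfl⟩ := (mem_hFold _ _ _).1 hy
    refine ⟨Fin.cons a f, ?_, ?_⟩
    · intro i
      refine Fin.cases ?_ ?_ i
      · simpa using ha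
      · intro i; simpa using hf i
    · rw [Fin.sum_univ_succ]; simp

theorem hFold_one {G : Type*} [AddCommMonoid G] [DecidableEq G] (A : Finset G) :
    hFoldSum 1 A = A := by
  ext x
  rw [mem_hFold]
  constructor
  · rintro ⟨f, hf, rfl⟩
    simpa using hf 0
  · intro hx
    exact ⟨fun _ => x, fun _ => hx, by simp⟩

theorem hFold_ne {G : Type*} [AddCommMonoid G] [DecidableEq G] (h : ℕ) (A : Finset G)
    (hA : A.Nonempty) : (hFoldSum h A).Nonempty := by
  obtain ⟨a, ha⟩ := hA
  exact ⟨_, (mem_hFold _ _ _).2 ⟨fun _ => a, fun _ => ha, rfl⟩⟩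

theorem stb_add {G : Type*} [AddCommGroup G] [DecidableEq G] (A B : Finset G) :
    stb B ≤ stb (A + B) := by
  intro g hg
  apply mem_stb_of
  intro c hc
  obtain ⟨a, ha, b, hb, rfl⟩ := Finset.mem_add.1 hc
  exact Finset.mem_add.2 ⟨a, ha, g + b, (hg b).2 hb, by abel⟩

theorem stb_hFold_mono {G : Type*} [AddCommGroup G] [DecidableEq G] (A : Finset G) {j h : ℕ}
    (hj : j ≤ h) : stb (hFoldSum j A) ≤ stb (hFoldSum h A) := by
  induction h, hj using Nat.le_induction with
  | base => exact le_rfl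
  | succ h _ ih => rw [hFold_succ]; exact ih.trans (stb_add _ _)

theorem kneser_h {G : Type*} [AddCommGroup G] [Fintype G] [DecidableEq G] (A : Finset G)
    (hA : A.Nonempty) (h : ℕ) (j : ℕ) (hj : j + 1 ≤ h) :
    (j + 1) * A.card ≤ (hFoldSum (j + 1) A).card + j * (fs (stb (hFoldSum h A))).card := by
  induction j with
  | zero => simp [hFold_one]
  | succ j ih =>
    have h1 := ih (by omega)
    have h2 := kneser_weak A (hFoldSum (j + 1) A) hA (hFold_ne _ _ hA)
    rw [← hFold_succ] at h2
    have h3 := fs_mono (stb_hFold_mono A hj)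
    nlinarith

theorem card_dvd_of_stab {G : Type*} [AddCommGroup G] [Fintype G] [DecidableEq G] (A : Finset G)
    (H : AddSubgroup G) (h : H ≤ stb A) : (fs H).card ∣ A.card := by
  classical
  have e : A.card = ∑ q ∈ A.image (QuotientAddGroup.mk : G → G ⧸ H), (fs H).card := by
    rw [Finset.card_eq_sum_card_image (QuotientAddGroup.mk : G → G ⧸ H) A]
    refine Finset.sum_congr rfl fun q hq => ?_
    obtain ⟨a, ha, rfl⟩ := Finset.mem_image.1 hq
    symm
    refine Finset.card_bij (fun g _ => g + a) ?_ ?_ ?_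
    · intro g hg
      rw [mem_fs] at hg
      rw [Finset.mem_filter]
      refine ⟨(h hg a).2 ha, ?_⟩
      rw [QuotientAddGroup.eq]
      have : -(g + a) + a = -g := by abel
      rw [this]; exact H.neg_mem hg
    · intro g _ g' _ e; simpa using e
    · intro b hb
      rw [Finset.mem_filter] at hb
      refine ⟨b - a, ?_, by simp⟩
      rw [mem_fs]
      have := (QuotientAddGroup.eq).1 hb.2.symm
      rwa [neg_add_eq_sub] at this
  rw [e, Finset.sum_const, smul_eq_mul]
  exact Dvd.intro_left _ rfl

theorem main_bound {G : Type*} [AddCommGroup G] [Fintype G] [DecidableEq G] (h : ℕ) (hh : 0 < h)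
    (A : Finset G) (hA : A.Nonempty) :
    ∃ d, d ∣ Fintype.card G ∧ 0 < d ∧ fd A.card h d ≤ (hFoldSum h A).card := by
  set H := stb (hFoldSum h A) with hH
  have hAA : A ⊆ A + fs H := fun a ha =>
    Finset.mem_add.2 ⟨a, ha, 0, (mem_fs _ _).2 H.zero_mem, by simp⟩
  have hsum : hFoldSum h (A + fs H) = hFoldSum h A := by
    ext x
    rw [mem_hFold]
    constructor
    · rintro ⟨f, hf, rfl⟩
      simp only [Finset.mem_add] at hf
      choose a ha g hg e using hf
      have : ∑ i, f i = (∑ i, g i) + ∑ i, a i := by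
        rw [← Finset.sum_add_distrib]
        exact Finset.sum_congr rfl fun i _ => by rw [← e i, add_comm]
      rw [this]
      have hm : ∑ i, g i ∈ H := H.sum_mem fun i _ => (mem_fs _ _).1 (hg i)
      exact (hm _).2 ((mem_hFold _ _ _).2 ⟨a, ha, rfl⟩)
    · intro hx
      obtain ⟨f, hf, e⟩ := (mem_hFold _ _ _).1 hx
      exact ⟨f, fun i => hAA (hf i), e⟩
  have hst : H ≤ stb (A + fs H) := by
    intro g hg
    apply mem_stb_of
    intro c hc
    obtain ⟨a, ha, b, hb, rfl⟩ := Finset.mem_add.1 hc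
    exact Finset.mem_add.2 ⟨a, ha, g + b,
      (mem_fs _ _).2 (H.add_mem hg ((mem_fs _ _).1 hb)), by abel⟩
  obtain ⟨t, ht⟩ := card_dvd_of_stab _ H hst
  obtain ⟨j, rfl⟩ : ∃ j, h = j + 1 := ⟨h - 1, by omega⟩
  have hk := kneser_h (A + fs H) (hA.mono hAA) (j + 1) j le_rfl
  rw [hsum, ← hH, ht] at hk
  have hle := Finset.card_le_card hAA
  rw [ht] at hle
  have hd := fs_pos H
  refine ⟨(fs H).card, ?_, hd, ?_⟩
  · have := card_dvd_of_stab (Finset.univ : Finset G) H (fun g _ c => by simp)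
    simpa using this
  · have hp := Finset.card_pos.2 hA
    generalize (fs H).card = d at *
    generalize (hFoldSum (j + 1) A).card = M at *
    generalize A.card = m at *
    unfold fd
    have hc : (m + d - 1) / d ≤ t := by
      rw [← Nat.lt_succ_iff, Nat.div_lt_iff_lt_mul hd]
      have : (t + 1) * d = d * t + d := by ring
      rw [Nat.succ_eq_add_one]
      omega
    obtain ⟨s, rfl⟩ : ∃ s, t = s + 1 := by
      refine ⟨t - 1, ?_⟩
      have : t ≠ 0 := by rintro rfl; omega
      omega
    have h1 : (j + 1) * ((m + d - 1) / d) - (j + 1) + 1 ≤ (j + 1) * s + 1 := by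
      have : (j + 1) * ((m + d - 1) / d) ≤ (j + 1) * (s + 1) := Nat.mul_le_mul_left _ hc
      rw [Nat.mul_succ] at this
      omega
    refine (Nat.mul_le_mul_right d h1).trans ?_
    nlinarith

end helpers

theorem stmt1 (n m h : ℕ) (hn : 0 < n) (hm : 0 < m) (hh : 0 < h) (hmn : m ≤ n)
    (G : Type*) [AddCommGroup G] [Fintype G] [DecidableEq G]
    (hG : Fintype.card G = n) :
    (∀ A : Finset G, A.card = m → uFun n m h ≤ (hFoldSum h A).card) ∧
    uFun n m h ≤ rho G m h := by
  have main : ∀ A : Finset G, A.card = m → uFun n m h ≤ (hFoldSum h A).card := by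
    intro A hA
    obtain ⟨d, h1, h2, h3⟩ := main_bound h hh A (Finset.card_pos.1 (by omega))
    rw [hA] at h3
    rw [hG] at h1
    have h4 : uFun n m h ≤ fd m h d := Nat.sInf_le ⟨d, h1, h2, rfl⟩
    exact h4.trans h3
  refine ⟨main, ?_⟩
  obtain ⟨A, -, hA⟩ := Finset.exists_subset_card_eq
    (s := (Finset.univ : Finset G)) (n := m) (by rw [Finset.card_univ]; omega)
  obtain ⟨B, hB, hB'⟩ := Nat.sInf_mem
    (s := { k | ∃ A : Finset G, A.card = m ∧ (hFoldSum h A).card = k }) ⟨_, A, hA, rfl⟩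
  unfold rho
  rw [← hB']
  exact main B hB
end

section
/- Let h ≥ 3 be an odd integer, and let m and n be positive integers such that m + 2 is divisible by h + 2 and n is divisible by hm − h², with h ≤ m−1. Then the set B = B_{h+2}(n, m; h+1, h+1, n/(hm−h²), (h+3)/2) is an m-element subset of Z_n whose h-fold restricted sumset has size |h^B| = hm − h² − 1. -/
open Finset

theorem aux_interval (L : ℕ) : ∀ (a : ℕ) (v : ℤ), a ≤ L → (a : ℤ) * (a - 1) ≤ 2 * v →
    2 * v ≤ (a : ℤ) * (a - 1) + 2 * a * (L - a) →
    ∃ s ⊆ range L, s.card = a ∧ ((∑ x ∈ s, x : ℕ) : ℤ) = v := by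
  induction L with
  | zero =>
    intro a v ha h1 h2
    obtain rfl : a = 0 := by omega
    refine ⟨∅, by simp, by simp, ?_⟩
    simp at h1 h2 ⊢
    omega
  | succ L ih =>
    intro a v ha h1 h2
    push_cast at h2
    by_cases hc : a ≤ L ∧ 2 * v ≤ (a : ℤ) * (a - 1) + 2 * a * (L - a)
    · obtain ⟨s, hs, hs2, hs3⟩ := ih a v hc.1 h1 hc.2
      exact ⟨s, hs.trans (range_subset_range.2 (by omega)), hs2, hs3⟩
    · rcases Nat.eq_zero_or_pos a with rfl | hpos
      · exfalso; apply hc; simp at h2 ⊢; exact h2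
      obtain ⟨b, rfl⟩ : ∃ b, a = b + 1 := ⟨a - 1, by omega⟩
      push_cast at *
      have hbL : (b : ℤ) ≤ L := by exact_mod_cast (by omega : b ≤ L)
      obtain ⟨s, hs, hs2, hs3⟩ := ih b (v - L) (by omega) (by
        by_cases hb : b + 1 ≤ L
        · have h3 : ¬ _ := fun h => hc ⟨hb, h⟩
          push Not at h3
          have : (b : ℤ) + 1 ≤ L := by exact_mod_cast hb
          obtain ⟨z, hz⟩ := Int.even_mul_succ_self (b : ℤ)
          have h4 := mul_nonneg (Int.natCast_nonneg b) (sub_nonneg.2 this)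
          have h5 : z + ((b : ℤ) + 1) * (L - (b + 1)) < v := by nlinarith
          nlinarith
        · have : (b : ℤ) = L := by exact_mod_cast (by omega : b = L)
          rw [this] at h1 ⊢
          nlinarith) (by nlinarith)
      have hnot : L ∉ s := fun h => by simpa using hs h
      refine ⟨insert L s, ?_, by rw [card_insert_of_notMem hnot, hs2], ?_⟩
      · intro x hx
        rcases mem_insert.1 hx with rfl | hx
        · simp
        · have := mem_range.1 (hs hx); simp; omega
      · rw [sum_insert hnot]; push_cast at *; omega

theorem aux_full (L a d : ℕ) (hd : 0 < d) (ha : a ≤ L) (hf : d ≤ a * (L - a) + 1) (w : ℤ) :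
    ∃ s ⊆ range L, s.card = a ∧ ((∑ x ∈ s, x : ℕ) : ℤ) ≡ w [ZMOD d] := by
  obtain ⟨b, hb⟩ : ∃ b : ℤ, (a : ℤ) * (a - 1) = 2 * b := by
    have := Int.even_mul_pred_self (a : ℤ)
    obtain ⟨b, hb⟩ := this
    exact ⟨b, by omega⟩
  have hd' : (0 : ℤ) < d := by exact_mod_cast hd
  have e1 := Int.emod_nonneg (w - b) hd'.ne'
  have e2 := Int.emod_lt_of_pos (w - b) hd'
  have hf' : (d : ℤ) ≤ a * (L - a) + 1 := by
    have : ((L - a : ℕ) : ℤ) = L - a := by omega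
    rw [← this]; exact_mod_cast hf
  obtain ⟨s, h1, h2, h3⟩ := aux_interval L a (b + (w - b) % d) ha (by omega) (by nlinarith)
  refine ⟨s, h1, h2, ?_⟩
  rw [h3]
  have := (Int.mod_modEq (w - b) d).add_left b
  simpa using this

/-- index set -/
def PP (h c : ℕ) : Finset (ℕ × ℕ) :=
  ((range (c + 1)) ×ˢ (range (h + 2))).filter (fun p => ¬ (p.2 = h + 1 ∧ (p.1 = 0 ∨ p.1 = c)))

def offs (h c i : ℕ) : ℕ := if i = c then (h + 3) / 2 else 0

def psi (h c : ℕ) (p : ℕ × ℕ) : ℕ := p.1 + h * c * (offs h c p.1 + p.2)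

theorem PP_card (h c : ℕ) (hc : 1 ≤ c) : (PP h c).card = (h + 2) * c + h := by
  have : PP h c = ((range (c + 1)) ×ˢ (range (h + 2))) \ {(0, h + 1), (c, h + 1)} := by
    ext ⟨i, j⟩
    simp [PP]
    grind
  rw [this, card_sdiff_of_subset, card_pair]
  · simp
    have : (c + 1) * (h + 2) = (h + 2) * c + h + 2 := by ring
    omega
  · simp; omega
  · intro x; simp; rintro (rfl | rfl) <;> simp

theorem sum_rect (s : Finset ℕ) (h c i : ℕ) :
    ∑ p ∈ ({i} : Finset ℕ) ×ˢ s, psi h c p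
      = s.card * i + h * c * (s.card * offs h c i + ∑ x ∈ s, x) := by
  rw [sum_product]
  simp [psi, sum_add_distrib, mul_add, mul_sum]
  ring

theorem psi_inj (h c : ℕ) (hh : 3 ≤ h) (hc : 1 ≤ c) (p p' : ℕ × ℕ)
    (hp : p ∈ PP h c) (hp' : p' ∈ PP h c)
    (he : psi h c p ≡ psi h c p' [MOD h * c * (h + 2)]) : p = p' := by
  obtain ⟨i, j⟩ := p
  obtain ⟨i', j'⟩ := p'
  simp only [PP, mem_filter, mem_product, mem_range] at hp hp'
  simp only [psi] at he
  have h1 : i ≡ i' [MOD h * c] := by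
    have := Nat.ModEq.of_mul_right _ he
    simpa [Nat.ModEq, Nat.add_mul_mod_self_left] using this
  have hlt : c + 1 ≤ h * c := by nlinarith
  have h2 : i = i' := Nat.ModEq.eq_of_lt_of_lt h1 (by omega) (by omega)
  subst h2
  have h3 := Nat.ModEq.add_left_cancel' _ he
  have h4 := Nat.ModEq.mul_left_cancel' (by positivity) h3
  have h5 := Nat.ModEq.add_left_cancel' _ h4
  have h6 : j = j' := Nat.ModEq.eq_of_lt_of_lt h5 (by omega) (by omega)
  rw [h6]

theorem sum_range_q (q : ℕ) : ∑ x ∈ range (2 * q + 1 + 1), x = (2 * q + 3) * q + 1 := by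
  have := Finset.sum_range_id_mul_two (2 * q + 1 + 1)
  simp at this
  nlinarith

theorem missing (h c q : ℕ) (hq : h = 2 * q + 1) (hc : 1 ≤ c)
    (s : Finset (ℕ × ℕ)) (hs : s ⊆ PP h c) (hcard : s.card = h)
    (he : ∑ p ∈ s, psi h c p ≡ h * c * 2 [MOD h * c * (h + 2)]) : False := by
  have hpos : 0 < h * c := by subst hq; positivity
  have key : ∀ i, (i = 0 ∨ i = c) → (∀ p ∈ s, p.1 = i) →
      ∃ x ≤ h, ∑ p ∈ s, psi h c p + h * c * x
        = h * i + h * c * (h * offs h c i + (2 * q + 3) * q + 1) := by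
    intro i hi hall
    obtain ⟨t, ht⟩ : ∃ t, t = s.image Prod.snd := ⟨_, rfl⟩
    have hst : s = {i} ×ˢ t := by
      ext ⟨a, b⟩
      simp only [ht, mem_product, mem_singleton, mem_image, Prod.exists]
      constructor
      · intro hab; exact ⟨hall _ hab, a, b, hab, rfl⟩
      · rintro ⟨rfl, a', b', hab, rfl⟩
        have := hall _ hab
        simp at this; subst this; exact hab
    have htc : t.card = h := by rw [hst] at hcard; simpa using hcard
    have htr : t ⊆ range (h + 1) := by
      intro b hb
      have : (i, b) ∈ PP h c := hs (by rw [hst]; simp [hb])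
      simp [PP] at this
      simp; grind
    obtain ⟨x, hx⟩ : ∃ x, range (h + 1) \ t = {x} := by
      rw [← card_eq_one, card_sdiff_of_subset htr]; simp [htc]
    have hsum := sum_sdiff (f := fun x => x) htr
    have hxm : x ∈ range (h + 1) \ t := by simp [hx]
    rw [hx, sum_singleton] at hsum
    refine ⟨x, by simp at hxm; omega, ?_⟩
    have e1 : ∑ p ∈ s, psi h c p = h * i + h * c * (h * offs h c i + ∑ x ∈ t, x) := by
      conv_lhs => rw [hst]
      rw [sum_rect, htc]
    have e2 : x + ∑ x ∈ t, x = (2 * q + 3) * q + 1 := by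
      rw [hsum, hq, sum_range_q]
    rw [e1, add_assoc, add_assoc, ← e2]
    ring
  have hdec : ∑ p ∈ s, psi h c p = ∑ p ∈ s, p.1 + h * c * ∑ p ∈ s, (offs h c p.1 + p.2) := by
    simp only [psi]
    rw [sum_add_distrib, mul_sum]
  have hle : ∀ p ∈ s, p.1 ≤ c := by
    intro p hp; have := hs hp; simp [PP] at this; omega
  have hT : ∑ p ∈ s, p.1 ≤ h * c := by
    have := sum_le_card_nsmul s (fun p => p.1) c hle
    rw [hcard] at this; simpa using this
  have hdvd : h * c ∣ ∑ p ∈ s, p.1 := by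
    have h1 := Nat.ModEq.of_mul_right _ he
    rw [hdec] at h1
    have : ∑ p ∈ s, p.1 ≡ 0 [MOD h * c] := by
      simpa [Nat.ModEq, Nat.add_mul_mod_self_left] using h1
    exact (Nat.modEq_zero_iff_dvd).1 this
  have hfin2 : ∀ x ≤ h, ∀ k, ∑ p ∈ s, psi h c p + h * c * x = h * c * (1 + (h + 2) * k) → False := by
    intro x hx k hk
    have h1 := he.add_right (h * c * x)
    rw [hk, ← mul_add] at h1
    have h2 := Nat.ModEq.mul_left_cancel' hpos.ne' h1
    have h5 : 1 + 0 ≡ 1 + (1 + x) [MOD h + 2] := by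
      have : 1 + (1 + x) = 2 + x := by ring
      rw [this]
      refine Nat.ModEq.trans ?_ h2
      simp [Nat.ModEq, Nat.add_mul_mod_self_left]
    have h6 := Nat.ModEq.eq_of_lt_of_lt (Nat.ModEq.add_left_cancel' _ h5) (by omega) (by omega)
    omega
  obtain ⟨k, hk⟩ := hdvd
  have hk1 : k = 0 ∨ k = 1 := by
    have : k ≤ 1 := by
      by_contra hcon
      have : h * c * 2 ≤ h * c * k := Nat.mul_le_mul_left _ (by omega)
      omega
    omega
  rcases hk1 with rfl | rfl
  · have hall : ∀ p ∈ s, p.1 = 0 := by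
      rw [mul_zero] at hk
      exact fun p hp => (sum_eq_zero_iff.1 hk) p hp
    obtain ⟨x, hx, hx2⟩ := key 0 (Or.inl rfl) hall
    refine hfin2 x hx q ?_
    rw [hx2, offs, if_neg (by omega), hq]; ring
  · have hall : ∀ p ∈ s, p.1 = c := by
      have h1 : ∑ p ∈ s, p.1 = ∑ p ∈ s, c := by rw [hk]; simp [hcard]
      exact (sum_eq_sum_iff_of_le hle).1 h1
    obtain ⟨x, hx, hx2⟩ := key c (Or.inr rfl) hall
    refine hfin2 x hx h ?_
    have : (h + 3) / 2 = q + 2 := by omega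
    rw [hx2, offs, if_pos rfl, this, hq]; ring

theorem rect_sub (h c i L : ℕ) (t : Finset ℕ) (ht : t ⊆ range L) (hi : i ≤ c) 
    (hL : L ≤ h + 1 ∨ (L ≤ h + 2 ∧ i ≠ 0 ∧ i ≠ c)) : ({i} : Finset ℕ) ×ˢ t ⊆ PP h c := by
  rintro ⟨a, b⟩ hab
  simp only [mem_product, mem_singleton] at hab
  have := mem_range.1 (ht hab.2)
  simp [PP]
  omega

theorem two_layer (h r : ℕ) (hh : 3 ≤ h) (hr : 1 ≤ r) (hr' : r < h) (w : ℤ) :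
    ∃ s ⊆ range (h + 1), ∃ t ⊆ range (h + 1), s.card = h - r ∧ t.card = r ∧
      ((∑ x ∈ s, x : ℕ) : ℤ) + ((∑ x ∈ t, x : ℕ) : ℤ) ≡ w [ZMOD (h + 2 : ℕ)] := by
  have main : ∀ a, 2 ≤ a → a < h → h + 2 ≤ a * (h + 1 - a) + 1 := by
    intro a h1 h2
    obtain ⟨b, rfl⟩ : ∃ b, h = a + 1 + b := ⟨h - a - 1, by omega⟩
    have : a + 1 + b + 1 - a = b + 2 := by omega
    rw [this]; nlinarith [Nat.zero_le (a*b), Nat.mul_le_mul_right b h1]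
  by_cases h2 : 2 ≤ r
  · have hs : range (h - r) ⊆ range (h + 1) := range_subset_range.2 (by omega)
    obtain ⟨t, t1, t2, t3⟩ := aux_full (h + 1) r (h + 2) (by omega) (by omega) (main r h2 hr')
      (w - ((∑ x ∈ range (h - r), x : ℕ) : ℤ))
    refine ⟨_, hs, t, t1, by simp, t2, ?_⟩
    simpa using t3.add_left ((∑ x ∈ range (h - r), x : ℕ) : ℤ)
  · have hs : range r ⊆ range (h + 1) := range_subset_range.2 (by omega)
    obtain ⟨t, t1, t2, t3⟩ := aux_full (h + 1) (h - r) (h + 2) (by omega) (by omega)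
      (main (h - r) (by omega) (by omega)) (w - ((∑ x ∈ range r, x : ℕ) : ℤ))
    refine ⟨t, t1, _, hs, t2, by simp, ?_⟩
    simpa using t3.add_right ((∑ x ∈ range r, x : ℕ) : ℤ)

theorem present (h c q : ℕ) (hh : 3 ≤ h) (hq : h = 2 * q + 1) (hc : 1 ≤ c) (k : ℕ)
    (hk : k < h * c * (h + 2)) (hk2 : k ≠ h * c * 2) :
    ∃ s ⊆ PP h c, s.card = h ∧ ∑ p ∈ s, psi h c p ≡ k [MOD h * c * (h + 2)] := by
  have hpos : 0 < h * c := by positivity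
  obtain ⟨u, t, hu, ht, rfl⟩ : ∃ u t, u < h + 2 ∧ t < h * c ∧ k = t + h * c * u :=
    ⟨k / (h * c), k % (h * c), Nat.div_lt_of_lt_mul hk, Nat.mod_lt _ hpos,
      (Nat.mod_add_div _ _).symm⟩
  rcases Nat.eq_zero_or_pos t with rfl | htpos
  · -- layer zero
    have hu2 : u ≠ 2 := by rintro rfl; simp at hk2
    obtain ⟨x, e, hx, hxe⟩ : ∃ x e, x ≤ h ∧ u + x = 1 + (h + 2) * e := by
      by_cases h1 : u ≤ 1
      · exact ⟨1 - u, 0, by omega, by omega⟩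
      · exact ⟨h + 3 - u, 1, by omega, by omega⟩
    have hxm : x ∈ range (h + 1) := by simp; omega
    have hsum := add_sum_erase (range (h + 1)) (fun x => x) hxm
    have hsq := sum_range_q q
    rw [← hq] at hsq
    rw [hsq] at hsum
    refine ⟨{0} ×ˢ (range (h + 1)).erase x,
      rect_sub h c 0 (h + 1) _ (erase_subset _ _) (by omega) (Or.inl le_rfl), ?_, ?_⟩
    · rw [card_product, card_erase_of_mem hxm]; simp
    · rw [sum_rect, offs, if_neg (by omega)]
      simp only [mul_zero, zero_add]
      apply Nat.ModEq.mul_left'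
      apply Nat.ModEq.add_left_cancel' x
      rw [hsum, add_comm x u, hxe]
      have : 2 * q + 3 = h + 2 := by omega
      rw [this]
      simp [Nat.ModEq, add_comm, Nat.add_mul_mod_self_left]
  · obtain ⟨i, r, hr, rfl⟩ : ∃ i r, r < h ∧ t = r + h * i :=
      ⟨t / h, t % h, Nat.mod_lt _ (by omega), (Nat.mod_add_div _ _).symm⟩
    have hic : i < c := by
      by_contra hcon
      have : h * c ≤ h * i := Nat.mul_le_mul_left _ (by omega)
      omega
    rcases Nat.eq_zero_or_pos r with rfl | hrpos
    · have hi0 : i ≠ 0 := by rintro rfl; simp at htpos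
      obtain ⟨s, s1, s2, s3⟩ := aux_full (h + 2) h (h + 2) (by omega) (by omega)
        (by rw [Nat.add_sub_cancel_left]; omega) (u : ℤ)
      refine ⟨{i} ×ˢ s, rect_sub h c i (h + 2) _ s1 hic.le
        (Or.inr ⟨le_rfl, hi0, hic.ne⟩), by simp [s2], ?_⟩
      rw [sum_rect, offs, if_neg hic.ne, s2]
      simp only [mul_zero, zero_add]
      exact (Nat.ModEq.mul_left' _ (Int.natCast_modEq_iff.1 s3)).add_left _
    · obtain ⟨s, s1, t, t1, s2, t2, h3⟩ := two_layer h r hh hrpos hr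
        ((u : ℤ) - (r * offs h c (i + 1) : ℕ) - ((h - r) * offs h c i : ℕ))
      have hdis : Disjoint (({i} : Finset ℕ) ×ˢ s) (({i + 1} : Finset ℕ) ×ˢ t) := by
        rw [disjoint_left]; rintro ⟨a, b⟩; simp; omega
      refine ⟨({i} ×ˢ s) ∪ ({i + 1} ×ˢ t), union_subset
        (rect_sub h c i (h + 1) _ s1 hic.le (Or.inl le_rfl))
        (rect_sub h c (i + 1) (h + 1) _ t1 hic (Or.inl le_rfl)), ?_, ?_⟩
      · rw [card_union_of_disjoint hdis]; simp [s2, t2]; omega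
      · rw [sum_union hdis, sum_rect, sum_rect, s2, t2]
        have e : (h - r) * i + h * c * ((h - r) * offs h c i + ∑ x ∈ s, x) +
            (r * (i + 1) + h * c * (r * offs h c (i + 1) + ∑ x ∈ t, x))
            = r + h * i + h * c * ((h - r) * offs h c i + r * offs h c (i + 1)
              + (∑ x ∈ s, x + ∑ x ∈ t, x)) := by
          obtain ⟨b, hb⟩ : ∃ b, h = r + b := ⟨h - r, by omega⟩
          have : h - r = b := by omega
          rw [this]
          have : h * i = r * i + b * i := by rw [hb]; ring
          rw [this]; ring
        rw [e]
        refine (Nat.ModEq.mul_left' _ ?_).add_left _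
        rw [← Int.natCast_modEq_iff]
        have := h3.add_left (((h - r) * offs h c i : ℕ) + (r * offs h c (i + 1) : ℕ) : ℤ)
        have e2 : ((((h - r) * offs h c i : ℕ) : ℤ) + (r * offs h c (i + 1) : ℕ)) +
          ((u : ℤ) - (r * offs h c (i + 1) : ℕ) - ((h - r) * offs h c i : ℕ)) = u := by ring
        rw [e2] at this
        rw [Nat.cast_add, Nat.cast_add, Nat.cast_add (∑ x ∈ s, x)]
        exact this

theorem Bset_eq (h n c : ℕ) (hc : 1 ≤ c) (g : ZMod n)
    (hQ : ((n / (h + 2) : ℕ) : ZMod n) = ((h * c : ℕ) : ZMod n) * g) :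
    Bset n (h + 2) (h + 1) (h + 1) c ((h + 3) / 2) g
      = (PP h c).image (fun p => ((psi h c p : ℕ) : ZMod n) * g) := by
  ext x
  simp only [Bset, hQ, mem_union, mem_image, mem_range, mem_product, mem_Ico, Prod.exists, PP,
    mem_filter, psi]
  constructor
  · rintro ((⟨j, hj, rfl⟩ | ⟨i, j, hij, rfl⟩) | ⟨j, hj, rfl⟩)
    · refine ⟨0, j, by omega, ?_⟩
      rw [offs, if_neg (by omega)]; push_cast; ring
    · refine ⟨i, j, by omega, ?_⟩
      rw [offs, if_neg (by omega), nsmul_eq_mul]; push_cast; ring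
    · refine ⟨c, j, by omega, ?_⟩
      rw [offs, if_pos rfl, nsmul_eq_mul]; push_cast; ring
  · rintro ⟨i, j, hij, rfl⟩
    by_cases h0 : i = 0
    · subst h0
      refine Or.inl (Or.inl ⟨j, by omega, ?_⟩)
      rw [offs, if_neg (by omega)]; push_cast; ring
    by_cases h1 : i = c
    · subst h1
      refine Or.inr ⟨j, by omega, ?_⟩
      rw [offs, if_pos rfl, nsmul_eq_mul]; push_cast; ring
    · refine Or.inl (Or.inr ⟨i, j, by omega, ?_⟩)
      rw [offs, if_neg (by omega), nsmul_eq_mul]; push_cast; ring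

theorem core (h c q n G : ℕ) (hh : 3 ≤ h) (hq : h = 2 * q + 1) (hc : 1 ≤ c) (hn : 0 < n)
    (hG : n = h * c * (h + 2) * G) :
    (Bset n (h + 2) (h + 1) (h + 1) c ((h + 3) / 2) (G : ZMod n)).card = (h + 2) * c + h ∧
    (hFoldRSum h (Bset n (h + 2) (h + 1) (h + 1) c ((h + 3) / 2) (G : ZMod n))).card
      = h * c * (h + 2) - 1 := by
  have hGpos : 0 < G := Nat.pos_of_ne_zero (by rintro rfl; simp at hG; omega)
  have hpos : 0 < h * c := by positivity
  have hiff : ∀ a b : ℕ, (a : ZMod n) * (G : ZMod n) = (b : ZMod n) * (G : ZMod n) ↔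
      a ≡ b [MOD h * c * (h + 2)] := by
    intro a b
    rw [← Nat.cast_mul, ← Nat.cast_mul, ZMod.natCast_eq_natCast_iff, hG]
    exact ⟨fun h => Nat.ModEq.mul_right_cancel' hGpos.ne' h, fun h => Nat.ModEq.mul_right' _ h⟩
  have hQ : ((n / (h + 2) : ℕ) : ZMod n) = ((h * c : ℕ) : ZMod n) * (G : ZMod n) := by
    rw [← Nat.cast_mul]
    congr 1
    apply Nat.div_eq_of_eq_mul_right (by omega)
    rw [hG]; ring
  have hinj : Set.InjOn (fun p => ((psi h c p : ℕ) : ZMod n) * (G : ZMod n)) (PP h c : Set (ℕ × ℕ)) := by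
    intro p hp p' hp' he
    exact psi_inj h c hh hc p p' hp hp' ((hiff _ _).1 he)
  rw [Bset_eq h n c hc _ hQ]
  refine ⟨by rw [card_image_of_injOn hinj, PP_card h c hc], ?_⟩
  have hmem : h * c * 2 ∈ range (h * c * (h + 2)) := by
    rw [mem_range]; exact Nat.mul_lt_mul_of_pos_left (by omega) hpos
  have hset : hFoldRSum h ((PP h c).image (fun p => ((psi h c p : ℕ) : ZMod n) * (G : ZMod n)))
      = ((range (h * c * (h + 2))).erase (h * c * 2)).image
        (fun k : ℕ => (k : ZMod n) * (G : ZMod n)) := by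
    ext y
    simp only [hFoldRSum, mem_image, mem_powersetCard]
    constructor
    · rintro ⟨S, ⟨hS1, hS2⟩, rfl⟩
      obtain ⟨s, hs, rfl⟩ := subset_image_iff.1 hS1
      have hinj' := hinj.mono (show (s : Set (ℕ × ℕ)) ⊆ PP h c from hs)
      rw [card_image_of_injOn hinj'] at hS2
      rw [sum_image hinj', ← sum_mul, ← Nat.cast_sum]
      refine ⟨(∑ p ∈ s, psi h c p) % (h * c * (h + 2)), ?_, (hiff _ _).2 (Nat.mod_modEq _ _)⟩
      rw [mem_erase, mem_range]
      refine ⟨fun he => missing h c q hq hc s hs hS2 ?_, Nat.mod_lt _ (by positivity)⟩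
      rw [← he]; exact (Nat.mod_modEq _ _).symm
    · rintro ⟨k, hk, rfl⟩
      rw [mem_erase, mem_range] at hk
      obtain ⟨s, hs, hs2, hs3⟩ := present h c q hh hq hc k hk.2 hk.1
      have hinj' := hinj.mono (show (s : Set (ℕ × ℕ)) ⊆ PP h c from hs)
      refine ⟨s.image (fun p => ((psi h c p : ℕ) : ZMod n) * (G : ZMod n)),
        ⟨image_subset_image hs, by rw [card_image_of_injOn hinj', hs2]⟩, ?_⟩
      rw [sum_image hinj', ← sum_mul, ← Nat.cast_sum]
      exact (hiff _ _).2 hs3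
  rw [hset, card_image_of_injOn, card_erase_of_mem hmem, card_range]
  intro a ha b hb he
  simp only [coe_erase, Set.mem_diff, mem_coe, mem_range] at ha hb
  exact Nat.ModEq.eq_of_lt_of_lt ((hiff a b).1 he) ha.1 hb.1

theorem stmt7 (h m n : ℕ) (hh3 : 3 ≤ h) (hodd : Odd h) (hm : 0 < m) (hn : 0 < n)
    (hdvd1 : h + 2 ∣ m + 2) (hdvd2 : h * m - h ^ 2 ∣ n) (hhm : h ≤ m - 1) :
    (Bset n (h + 2) (h + 1) (h + 1) ((m + 2) / (h + 2) - 1) ((h + 3) / 2)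
        ((n / (h * m - h ^ 2) : ℕ) : ZMod n)).card = m ∧
    (hFoldRSum h (Bset n (h + 2) (h + 1) (h + 1) ((m + 2) / (h + 2) - 1) ((h + 3) / 2)
        ((n / (h * m - h ^ 2) : ℕ) : ZMod n))).card = h * m - h ^ 2 - 1 := by
  obtain ⟨q, hq⟩ := hodd
  obtain ⟨e, he⟩ := hdvd1
  have he2 : 2 ≤ e := by
    by_contra hcon
    have : (h + 2) * e ≤ (h + 2) * 1 := Nat.mul_le_mul_left _ (by omega)
    omega
  obtain ⟨c, rfl⟩ : ∃ c, e = c + 1 := ⟨e - 1, by omega⟩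
  have hm' : m = (h + 2) * c + h := by
    have : (h + 2) * (c + 1) = (h + 2) * c + h + 2 := by ring
    omega
  have hN : h * m - h ^ 2 = h * c * (h + 2) := by
    have : h * m = h * c * (h + 2) + h ^ 2 := by rw [hm']; ring
    omega
  have hc' : (m + 2) / (h + 2) - 1 = c := by
    rw [he, Nat.mul_div_cancel_left _ (by omega)]; rfl
  rw [hN] at hdvd2
  obtain ⟨G, hG⟩ := hdvd2
  have hpos : 0 < h * c * (h + 2) := by
    have : 0 < c := by omega
    positivity
  have hG' : n / (h * c * (h + 2)) = G := by
    rw [hG, Nat.mul_div_cancel_left _ hpos]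
  rw [hc', hN, hG']
  have := core h c q n G hh3 hq (by omega) hn hG
  rw [← hm'] at this
  exact this
end
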